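/- arXiv:math/0611319 — 2 statements merged into one kernel-verified Lean document; each statement's English description precedes it below -/
import Mathlib

section
/- Let u : ℝ × [0,∞) → ℝ be a smooth function, 2π-periodic in its first variable, with u(θ,t) > 0 everywhere, satisfying the normalized affine flow ∂_t u = (1/4)(κ − κ̄)·u with κ(θ,t) = u³·(∂²_θ u + u), κ̄(t) = (∫_0^{2π} κ u^{−2} dθ)/(∫_0^{2π} u^{−2} dθ), ∫_0^{2π} u(θ,0)^{−2} dθ = 2π, and satisfying the orthogonality condition ∫_0^{2π} u(θ,0)^{−3} cos θ dθ = ∫_0^{2π} u(θ,0)^{−3} sin θ dθ = 0. Define the support function h(θ,t) = sin θ·∫_0^θ u(φ,t)^{−3} cos φ dφ − cos θ·∫_0^θ u(φ,t)^{−3} sin φ dφ and the enclosed Euclidean area A(t) = (1/2)·∫_0^{2π} h(θ,t)·u(θ,t)^{−3} dθ. Then A satisfies the evolution equation d/dt A(t) = (3/2)·κ̄(t)·A(t) − (3/2)·π for all t ≥ 0. -/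
open Real MeasureTheory

/-- Differentiation under the integral sign over a compact interval, for a jointly continuous
derivative. -/
theorem hasDerivAt_intervalIntegral_of_continuous {F F' : ℝ → ℝ → ℝ}
    (hF : ∀ t, Continuous fun θ => F θ t)
    (hF' : Continuous fun p : ℝ × ℝ => F' p.1 p.2)
    (hd : ∀ θ t, HasDerivAt (fun s => F θ s) (F' θ t) t) (a b t : ℝ) :
    HasDerivAt (fun s => ∫ θ in a..b, F θ s) (∫ θ in a..b, F' θ t) t := by
  have hcompact : IsCompact (Set.uIcc a b ×ˢ Set.Icc (t - 1) (t + 1)) :=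
    isCompact_uIcc.prod isCompact_Icc
  obtain ⟨C, hC⟩ := hcompact.exists_bound_of_continuousOn hF'.continuousOn
  have hF't : Continuous fun θ => F' θ t := by fun_prop
  refine (intervalIntegral.hasDerivAt_integral_of_dominated_loc_of_deriv_le
    (F := fun s θ => F θ s) (F' := fun s θ => F' θ s) (bound := fun _ => C)
    (s := Set.Icc (t - 1) (t + 1)) (Icc_mem_nhds (by linarith) (by linarith))
    (.of_forall fun s => (hF s).aestronglyMeasurable) ((hF t).intervalIntegrable _ _)
    hF't.aestronglyMeasurable ?_ intervalIntegrable_const ?_).2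
  · exact .of_forall fun θ hθ s hs => hC (θ, s) ⟨Set.uIoc_subset_uIcc hθ, hs⟩
  · exact .of_forall fun θ _ s _ => hd θ s

/-- A solution on `[0, ∞)` of `f' = k f` vanishing at `0` is zero. -/
theorem eq_zero_of_hasDerivAt_mul_of_eq_zero {f k : ℝ → ℝ} (hk : Continuous k)
    (hf : ∀ t, 0 ≤ t → HasDerivAt f (k t * f t) t) (h0 : f 0 = 0) {t : ℝ} (ht : 0 ≤ t) :
    f t = 0 := by
  have hd : ∀ s, 0 ≤ s → HasDerivAt (fun s => f s * exp (-∫ r in (0:ℝ)..s, k r)) 0 s := by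
    intro s hs
    have h1 := (hk.integral_hasStrictDerivAt 0 s).hasDerivAt.fun_neg.exp
    exact ((hf s hs).fun_mul h1).congr_deriv (by ring)
  have h1 := constant_of_has_deriv_right_zero (a := 0) (b := t)
    (fun s hs => (hd s hs.1).continuousAt.continuousWithinAt)
    (fun s hs => (hd s hs.1).hasDerivWithinAt) t ⟨ht, le_rfl⟩
  simpa [h0, (exp_pos _).ne'] using h1

theorem contDiff_deriv_fst {F : ℝ → ℝ → ℝ}
    (hF : ContDiff ℝ (⊤ : ℕ∞) fun p : ℝ × ℝ => F p.1 p.2) :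
    ContDiff ℝ (⊤ : ℕ∞) (fun p : ℝ × ℝ => deriv (fun x => F x p.2) p.1) ∧
      ∀ x t, HasDerivAt (fun x => F x t) (deriv (fun x => F x t) x) x := by
  have key : ∀ x t, HasDerivAt (fun x => F x t)
      (fderiv ℝ (fun p : ℝ × ℝ => F p.1 p.2) (x, t) (1, 0)) x := fun x t =>
    (hF.differentiable (by simp) (x, t)).hasFDerivAt.comp_hasDerivAt (f := fun x => (x, t)) x
      ((hasDerivAt_id x).prodMk (hasDerivAt_const x t))
  refine ⟨?_, fun x t => (key x t).differentiableAt.hasDerivAt⟩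
  have : (fun p : ℝ × ℝ => deriv (fun x => F x p.2) p.1) =
      fun p => fderiv ℝ (fun p : ℝ × ℝ => F p.1 p.2) p (1, 0) :=
    funext fun p => (key p.1 p.2).deriv
  rw [this]
  exact (hF.fderiv_right (by simp)).clm_apply contDiff_const

theorem contDiff_deriv_snd {F : ℝ → ℝ → ℝ}
    (hF : ContDiff ℝ (⊤ : ℕ∞) fun p : ℝ × ℝ => F p.1 p.2) :
    ContDiff ℝ (⊤ : ℕ∞) (fun p : ℝ × ℝ => deriv (fun s => F p.1 s) p.2) ∧
      ∀ x t, HasDerivAt (fun s => F x s) (deriv (fun s => F x s) t) t := by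
  have hswap : ContDiff ℝ (⊤ : ℕ∞) fun p : ℝ × ℝ => F p.2 p.1 :=
    hF.comp (contDiff_snd.prodMk contDiff_fst)
  obtain ⟨h1, h2⟩ := contDiff_deriv_fst (F := fun t x => F x t) hswap
  exact ⟨h1.comp (contDiff_snd.prodMk contDiff_fst), fun x t => h2 t x⟩

section SupportFunction

/-- The solution of `h'' + h = w` with `h 0 = h' 0 = 0`. -/
noncomputable def supportOf (w : ℝ → ℝ) (θ : ℝ) : ℝ :=
  sin θ * (∫ φ in (0:ℝ)..θ, w φ * cos φ) - cos θ * ∫ φ in (0:ℝ)..θ, w φ * sin φ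

/-- The derivative of `supportOf w`. -/
noncomputable def supportDerivOf (w : ℝ → ℝ) (θ : ℝ) : ℝ :=
  cos θ * (∫ φ in (0:ℝ)..θ, w φ * cos φ) + sin θ * ∫ φ in (0:ℝ)..θ, w φ * sin φ

variable {w : ℝ → ℝ}

theorem hasDerivAt_supportOf (hw : Continuous w) (θ : ℝ) :
    HasDerivAt (supportOf w) (supportDerivOf w θ) θ := by
  have hc := ((hw.mul continuous_cos).integral_hasStrictDerivAt 0 θ).hasDerivAt
  have hs := ((hw.mul continuous_sin).integral_hasStrictDerivAt 0 θ).hasDerivAt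
  refine (((hasDerivAt_sin θ).fun_mul hc).fun_sub
    ((hasDerivAt_cos θ).fun_mul hs)).congr_deriv ?_
  simp only [supportDerivOf, Pi.mul_apply]
  ring

theorem hasDerivAt_supportDerivOf (hw : Continuous w) (θ : ℝ) :
    HasDerivAt (supportDerivOf w) (w θ - supportOf w θ) θ := by
  have hc := ((hw.mul continuous_cos).integral_hasStrictDerivAt 0 θ).hasDerivAt
  have hs := ((hw.mul continuous_sin).integral_hasStrictDerivAt 0 θ).hasDerivAt
  refine (((hasDerivAt_cos θ).fun_mul hc).fun_add
    ((hasDerivAt_sin θ).fun_mul hs)).congr_deriv ?_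
  simp only [supportOf, Pi.mul_apply]
  linear_combination w θ * sin_sq_add_cos_sq θ

theorem continuous_supportOf (hw : Continuous w) : Continuous (supportOf w) :=
  continuous_iff_continuousAt.2 fun θ => (hasDerivAt_supportOf hw θ).continuousAt

variable {f f' f'' : ℝ → ℝ}

theorem integral_deriv_add_mul_cos (hf : ∀ θ, HasDerivAt f (f' θ) θ)
    (hf' : ∀ θ, HasDerivAt f' (f'' θ) θ) (hc : Continuous f'') (θ : ℝ) :
    ∫ φ in (0:ℝ)..θ, (f'' φ + f φ) * cos φ = f' θ * cos θ + f θ * sin θ - f' 0 := by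
  have hfc : Continuous f := continuous_iff_continuousAt.2 fun θ => (hf θ).continuousAt
  rw [intervalIntegral.integral_eq_sub_of_hasDerivAt
    (f := fun θ => f' θ * cos θ + f θ * sin θ)]
  · simp
  · intro x _
    exact (((hf' x).fun_mul (hasDerivAt_cos x)).fun_add
      ((hf x).fun_mul (hasDerivAt_sin x))).congr_deriv (by ring)
  · exact Continuous.intervalIntegrable (by fun_prop) _ _

theorem integral_deriv_add_mul_sin (hf : ∀ θ, HasDerivAt f (f' θ) θ)
    (hf' : ∀ θ, HasDerivAt f' (f'' θ) θ) (hc : Continuous f'') (θ : ℝ) :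
    ∫ φ in (0:ℝ)..θ, (f'' φ + f φ) * sin φ = f' θ * sin θ - f θ * cos θ + f 0 := by
  have hfc : Continuous f := continuous_iff_continuousAt.2 fun θ => (hf θ).continuousAt
  rw [intervalIntegral.integral_eq_sub_of_hasDerivAt
    (f := fun θ => f' θ * sin θ - f θ * cos θ)]
  · simp
  · intro x _
    exact (((hf' x).fun_mul (hasDerivAt_sin x)).fun_sub
      ((hf x).fun_mul (hasDerivAt_cos x))).congr_deriv (by ring)
  · exact Continuous.intervalIntegrable (by fun_prop) _ _

theorem supportOf_deriv_add (hf : ∀ θ, HasDerivAt f (f' θ) θ)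
    (hf' : ∀ θ, HasDerivAt f' (f'' θ) θ) (hc : Continuous f'') (θ : ℝ) :
    supportOf (fun φ => f'' φ + f φ) θ = f θ - f 0 * cos θ - f' 0 * sin θ := by
  simp only [supportOf]
  rw [integral_deriv_add_mul_cos hf hf' hc, integral_deriv_add_mul_sin hf hf' hc]
  linear_combination f θ * sin_sq_add_cos_sq θ

/-- Under the orthogonality condition `L = ∂² + 1` is symmetric when tested on `supportOf w`. -/
theorem integral_supportOf_mul_deriv_add (hw : Continuous w)
    (hwc : ∫ θ in (0:ℝ)..(2 * π), w θ * cos θ = 0)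
    (hws : ∫ θ in (0:ℝ)..(2 * π), w θ * sin θ = 0)
    (hf : ∀ θ, HasDerivAt f (f' θ) θ)
    (hf' : ∀ θ, HasDerivAt f' (f'' θ) θ) (hc : Continuous f'') :
    ∫ θ in (0:ℝ)..(2 * π), supportOf w θ * (f'' θ + f θ) =
      ∫ θ in (0:ℝ)..(2 * π), w θ * f θ := by
  have hfc : Continuous f := continuous_iff_continuousAt.2 fun θ => (hf θ).continuousAt
  have hsc := continuous_supportOf hw
  rw [← sub_eq_zero, ← intervalIntegral.integral_sub
    (Continuous.intervalIntegrable (by fun_prop) _ _)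
    (Continuous.intervalIntegrable (by fun_prop) _ _)]
  rw [intervalIntegral.integral_eq_sub_of_hasDerivAt
    (f := fun θ => supportOf w θ * f' θ - supportDerivOf w θ * f θ)]
  · simp [supportOf, supportDerivOf, hwc, hws]
  · intro x _
    exact (((hasDerivAt_supportOf hw x).fun_mul (hf' x)).fun_sub
      ((hasDerivAt_supportDerivOf hw x).fun_mul (hf x))).congr_deriv (by ring)
  · exact Continuous.intervalIntegrable (by fun_prop) _ _

theorem supportOf_linear_combination {g : ℝ → ℝ} (hw : Continuous w) (hg : Continuous g)
    (a b θ : ℝ) : supportOf (fun φ => a * g φ + b * w φ) θ =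
      a * supportOf g θ + b * supportOf w θ := by
  have key : ∀ T : ℝ → ℝ, Continuous T → ∫ φ in (0:ℝ)..θ, (a * g φ + b * w φ) * T φ =
      a * (∫ φ in (0:ℝ)..θ, g φ * T φ) + b * ∫ φ in (0:ℝ)..θ, w φ * T φ := by
    intro T hT
    rw [← intervalIntegral.integral_const_mul, ← intervalIntegral.integral_const_mul,
      ← intervalIntegral.integral_add (Continuous.intervalIntegrable (by fun_prop) _ _)
        (Continuous.intervalIntegrable (by fun_prop) _ _)]
    congr 1; ext φ; ring
  simp only [supportOf]
  rw [key _ continuous_cos, key _ continuous_sin]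
  ring

theorem hasDerivAt_supportOf_param {w v : ℝ → ℝ → ℝ}
    (hw : ∀ t, Continuous fun θ => w θ t)
    (hv : Continuous fun p : ℝ × ℝ => v p.1 p.2)
    (hd : ∀ θ t, HasDerivAt (fun s => w θ s) (v θ t) t) (θ t : ℝ) :
    HasDerivAt (fun s => supportOf (fun φ => w φ s) θ) (supportOf (fun φ => v φ t) θ) t := by
  have key : ∀ T : ℝ → ℝ, Continuous T → HasDerivAt (fun s => ∫ φ in (0:ℝ)..θ, w φ s * T φ)
      (∫ φ in (0:ℝ)..θ, v φ t * T φ) t := fun T hT =>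
    hasDerivAt_intervalIntegral_of_continuous (fun s => (hw s).mul hT)
      (F' := fun φ s => v φ s * T φ) (by fun_prop) (fun φ s => (hd φ s).mul_const _) _ _ _
  exact ((key _ continuous_cos).const_mul _).fun_sub ((key _ continuous_sin).const_mul _)

theorem continuous_supportOf_param {v : ℝ → ℝ → ℝ}
    (hv : Continuous fun p : ℝ × ℝ => v p.1 p.2) :
    Continuous fun p : ℝ × ℝ => supportOf (fun φ => v φ p.2) p.1 := by
  have key : ∀ T : ℝ → ℝ, Continuous T →
      Continuous fun p : ℝ × ℝ => ∫ φ in (0:ℝ)..p.1, v φ p.2 * T φ := fun T hT =>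
    intervalIntegral.continuous_parametric_intervalIntegral_of_continuous
      (f := fun (p : ℝ × ℝ) φ => v φ p.2 * T φ)
      (show Continuous fun q : (ℝ × ℝ) × ℝ => v q.2 q.1.2 * T q.2 by fun_prop) continuous_fst
  have h1 := key _ continuous_cos
  have h2 := key _ continuous_sin
  simp only [supportOf]
  fun_prop

/-- First variation of `∫ h w`, where `h = supportOf w`, in the direction
`a (f'' + f) + b w`. -/
theorem integral_variation_supportOf (hw : Continuous w)
    (hwc : ∫ θ in (0:ℝ)..(2 * π), w θ * cos θ = 0)
    (hws : ∫ θ in (0:ℝ)..(2 * π), w θ * sin θ = 0)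
    (hf : ∀ θ, HasDerivAt f (f' θ) θ)
    (hf' : ∀ θ, HasDerivAt f' (f'' θ) θ) (hc : Continuous f'') (a b : ℝ) :
    ∫ θ in (0:ℝ)..(2 * π), (supportOf (fun φ => a * (f'' φ + f φ) + b * w φ) θ * w θ +
        supportOf w θ * (a * (f'' θ + f θ) + b * w θ)) =
      2 * a * (∫ θ in (0:ℝ)..(2 * π), w θ * f θ) +
        2 * b * ∫ θ in (0:ℝ)..(2 * π), supportOf w θ * w θ := by
  have hfc : Continuous f := continuous_iff_continuousAt.2 fun θ => (hf θ).continuousAt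
  have hsc := continuous_supportOf hw
  have hint : ∀ θ, supportOf (fun φ => a * (f'' φ + f φ) + b * w φ) θ * w θ +
        supportOf w θ * (a * (f'' θ + f θ) + b * w θ) =
      a * (w θ * f θ) - a * f 0 * (w θ * cos θ) - a * f' 0 * (w θ * sin θ) +
        a * (supportOf w θ * (f'' θ + f θ)) + 2 * b * (supportOf w θ * w θ) := by
    intro θ
    rw [supportOf_linear_combination (g := fun φ => f'' φ + f φ) hw (hc.add hfc),
      supportOf_deriv_add hf hf' hc]
    ring
  simp only [hint]
  rw [intervalIntegral.integral_add, intervalIntegral.integral_add,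
    intervalIntegral.integral_sub, intervalIntegral.integral_sub]
  · simp only [intervalIntegral.integral_const_mul]
    rw [hwc, hws, integral_supportOf_mul_deriv_add hw hwc hws hf hf' hc]
    ring
  all_goals exact Continuous.intervalIntegrable (by fun_prop) _ _

end SupportFunction

/-- Evolution of the enclosed Euclidean area along the normalized affine flow:
`A'(t) = (3/2)κ̄(t)A(t) − (3/2)π`, where `h` is the support function of the
corresponding convex curve and `A = ½∫ h u⁻³ dθ`. -/
theorem affine_flow_area_evolution
    (u : ℝ → ℝ → ℝ)
    (hu : ContDiff ℝ (⊤ : ℕ∞) (fun p : ℝ × ℝ => u p.1 p.2))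
    (huper : ∀ θ t, u (θ + 2 * π) t = u θ t)
    (hupos : ∀ θ t, 0 < u θ t)
    (kappa : ℝ → ℝ → ℝ)
    (hkappa : ∀ θ t, kappa θ t = (u θ t) ^ 3 * (deriv (deriv (fun x => u x t)) θ + u θ t))
    (kbar : ℝ → ℝ)
    (hkbar : ∀ t, kbar t =
      (∫ θ in (0:ℝ)..(2 * π), kappa θ t * ((u θ t) ^ 2)⁻¹) /
        ∫ θ in (0:ℝ)..(2 * π), ((u θ t) ^ 2)⁻¹)
    (hflow : ∀ θ t, 0 ≤ t →
      deriv (fun s => u θ s) t = (1 / 4) * (kappa θ t - kbar t) * u θ t)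
    (hnorm : ∫ θ in (0:ℝ)..(2 * π), ((u θ 0) ^ 2)⁻¹ = 2 * π)
    (horth0c : ∫ θ in (0:ℝ)..(2 * π), ((u θ 0) ^ 3)⁻¹ * Real.cos θ = 0)
    (horth0s : ∫ θ in (0:ℝ)..(2 * π), ((u θ 0) ^ 3)⁻¹ * Real.sin θ = 0)
    (h : ℝ → ℝ → ℝ)
    (hh : ∀ θ t, h θ t =
      Real.sin θ * (∫ φ in (0:ℝ)..θ, ((u φ t) ^ 3)⁻¹ * Real.cos φ)
        - Real.cos θ * ∫ φ in (0:ℝ)..θ, ((u φ t) ^ 3)⁻¹ * Real.sin φ)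
    (A : ℝ → ℝ)
    (hA : ∀ t, A t = (1 / 2) * ∫ θ in (0:ℝ)..(2 * π), h θ t * ((u θ t) ^ 3)⁻¹) :
    ∀ t : ℝ, 0 ≤ t →
      deriv A t = (3 / 2) * kbar t * A t - (3 / 2) * π := by
  have hpi : (0:ℝ) < 2 * π := by positivity
  obtain ⟨hu1, hd1⟩ := contDiff_deriv_fst hu
  obtain ⟨hu2, hd2⟩ := contDiff_deriv_fst (F := fun x t => deriv (fun y => u y t) x) hu1
  obtain ⟨hut, hdt⟩ := contDiff_deriv_snd hu
  set u1 : ℝ → ℝ → ℝ := fun x t => deriv (fun y => u y t) x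
  set u2 : ℝ → ℝ → ℝ := fun x t => deriv (fun y => u1 y t) x
  set ut : ℝ → ℝ → ℝ := fun x t => deriv (fun s => u x s) t with hut_def
  have hu2_c : Continuous fun p : ℝ × ℝ => u2 p.1 p.2 := hu2.continuous
  have hut_c : Continuous fun p : ℝ × ℝ => ut p.1 p.2 := hut.continuous
  have hu_c : Continuous fun p : ℝ × ℝ => u p.1 p.2 := hu.continuous
  have hne : ∀ θ t, u θ t ≠ 0 := fun θ t => (hupos θ t).ne'
  have hpow_c : ∀ n : ℕ, Continuous fun p : ℝ × ℝ => (u p.1 p.2 ^ n)⁻¹ := fun n =>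
    (hu_c.pow n).inv₀ fun p => pow_ne_zero _ (hne _ _)
  have hkappa' : ∀ θ t, kappa θ t = u θ t ^ 3 * (u2 θ t + u θ t) := hkappa
  have hkappa_c : Continuous fun p : ℝ × ℝ => kappa p.1 p.2 := by
    simp only [hkappa']
    fun_prop
  have hden : ∀ t, 0 < ∫ θ in (0:ℝ)..(2 * π), ((u θ t) ^ 2)⁻¹ := fun t =>
    intervalIntegral.intervalIntegral_pos_of_pos
      (((hpow_c 2).comp (Continuous.prodMk_left t)).intervalIntegrable _ _)
      (fun θ => inv_pos.2 (pow_pos (hupos θ t) 2)) hpi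
  have hkbar_c : Continuous kbar := by
    rw [funext hkbar]
    refine Continuous.div ?_ ?_ fun t => (hden t).ne'
    · exact intervalIntegral.continuous_parametric_intervalIntegral_of_continuous'
        (f := fun t θ => kappa θ t * ((u θ t) ^ 2)⁻¹)
        ((hkappa_c.mul (hpow_c 2)).comp continuous_swap) _ _
    · exact intervalIntegral.continuous_parametric_intervalIntegral_of_continuous'
        (f := fun t θ => ((u θ t) ^ 2)⁻¹) ((hpow_c 2).comp continuous_swap) _ _
  have hut_eq : ∀ θ t, 0 ≤ t → ut θ t = (1 / 4) * (kappa θ t - kbar t) * u θ t := hflow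
  have hdpow : ∀ (n : ℕ) (θ t : ℝ), HasDerivAt (fun s => (u θ s ^ (n + 1))⁻¹)
      (-(n + 1 : ℝ) * ut θ t * (u θ t ^ (n + 2))⁻¹) t := by
    intro n θ t
    refine (((hdt θ t).fun_pow (n + 1)).fun_inv (pow_ne_zero _ (hne θ t))).congr_deriv ?_
    have := hne θ t
    simp only [hut_def]
    field_simp
    push_cast
    simp
    ring
  set w : ℝ → ℝ → ℝ := fun θ t => (u θ t ^ 3)⁻¹ with hw_def
  set v : ℝ → ℝ → ℝ := fun θ t => -3 * ut θ t * (u θ t ^ 4)⁻¹ with hv_def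
  have hw_c : Continuous fun p : ℝ × ℝ => w p.1 p.2 := hpow_c 3
  have hwt_c : ∀ t, Continuous fun θ => w θ t := fun t => by fun_prop
  have hv_c : Continuous fun p : ℝ × ℝ => v p.1 p.2 :=
    (hut_c.const_mul _).mul (hpow_c 4)
  have hdw : ∀ θ t, HasDerivAt (fun s => w θ s) (v θ t) t := fun θ t =>
    (hdpow 2 θ t).congr_deriv (by simp only [hv_def]; norm_num)
  have hv_eq : ∀ t, 0 ≤ t → ∀ θ,
      v θ t = -(3 / 4) * (u2 θ t + u θ t) + 3 / 4 * kbar t * w θ t := by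
    intro t ht θ
    have := hne θ t
    simp only [hv_def, hw_def, hut_eq θ t ht, hkappa']
    field_simp
    ring
  have hu2t_c : ∀ t, Continuous fun θ => u2 θ t := fun t => by fun_prop
  have hu_slice_c : ∀ t, Continuous fun θ => u θ t := fun t => by fun_prop
  have hper1 : ∀ t, u1 (2 * π) t = u1 0 t := by
    intro t
    have h1 : (fun y => u (y + 2 * π) t) = fun y => u y t := funext fun y => huper y t
    have h2 := deriv_comp_add_const (fun y => u y t) (2 * π) 0
    rw [h1, zero_add] at h2
    exact h2.symm
  have hper0 : ∀ t, u (2 * π) t = u 0 t := fun t => by simpa using huper 0 t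
  have horth : ∀ T : ℝ → ℝ, Continuous T →
      (∀ t, ∫ θ in (0:ℝ)..(2 * π), (u2 θ t + u θ t) * T θ = 0) →
      ∫ θ in (0:ℝ)..(2 * π), w θ 0 * T θ = 0 →
      ∀ t, 0 ≤ t → ∫ θ in (0:ℝ)..(2 * π), w θ t * T θ = 0 := by
    intro T hT hT0 h0 t ht
    refine eq_zero_of_hasDerivAt_mul_of_eq_zero
      (f := fun t => ∫ θ in (0:ℝ)..(2 * π), w θ t * T θ) (k := fun t => 3 / 4 * kbar t)
      (by fun_prop) (fun t ht => ?_) h0 ht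
    refine (hasDerivAt_intervalIntegral_of_continuous (F := fun θ t => w θ t * T θ)
      (F' := fun θ t => v θ t * T θ) (fun s => (hwt_c s).mul hT) (by fun_prop)
      (fun φ s => (hdw φ s).mul_const _) 0 (2 * π) t).congr_deriv ?_
    have hint : ∀ θ, v θ t * T θ =
        -(3 / 4) * ((u2 θ t + u θ t) * T θ) + 3 / 4 * kbar t * (w θ t * T θ) := by
      intro θ
      rw [hv_eq t ht θ]
      ring
    have := hu2t_c t
    have := hu_slice_c t
    have := hwt_c t
    simp only [hint]
    rw [intervalIntegral.integral_add (Continuous.intervalIntegrable (by fun_prop) _ _)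
      (Continuous.intervalIntegrable (by fun_prop) _ _)]
    simp only [intervalIntegral.integral_const_mul]
    rw [hT0 t]
    ring
  have horthc := horth cos continuous_cos (fun t => by
    rw [integral_deriv_add_mul_cos (f := fun θ => u θ t) (f' := fun θ => u1 θ t)
      (f'' := fun θ => u2 θ t) (fun θ => hd1 θ t) (fun θ => hd2 θ t) (hu2t_c t)]
    simp [hper1]) horth0c
  have horths := horth sin continuous_sin (fun t => by
    rw [integral_deriv_add_mul_sin (f := fun θ => u θ t) (f' := fun θ => u1 θ t)
      (f'' := fun θ => u2 θ t) (fun θ => hd1 θ t) (fun θ => hd2 θ t) (hu2t_c t)]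
    simp [hper0]) horth0s
  have hnorm_t : ∀ t, 0 ≤ t → ∫ θ in (0:ℝ)..(2 * π), ((u θ t) ^ 2)⁻¹ = 2 * π := by
    intro t ht
    have hd : ∀ s, 0 ≤ s →
        HasDerivAt (fun s => ∫ θ in (0:ℝ)..(2 * π), ((u θ s) ^ 2)⁻¹) 0 s := by
      intro s hs
      refine (hasDerivAt_intervalIntegral_of_continuous (F := fun θ t => (u θ t ^ 2)⁻¹)
        (F' := fun θ t => -2 * ut θ t * (u θ t ^ 3)⁻¹)
        (fun s => (hpow_c 2).comp (Continuous.prodMk_left s))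
        ((hut_c.const_mul _).mul (hpow_c 3))
        (fun θ t => (hdpow 1 θ t).congr_deriv (by norm_num)) 0 (2 * π) s).congr_deriv ?_
      have hint : ∀ θ, -2 * ut θ s * (u θ s ^ 3)⁻¹ =
          -(1 / 2) * (kappa θ s * (u θ s ^ 2)⁻¹) + 1 / 2 * kbar s * (u θ s ^ 2)⁻¹ := by
        intro θ
        have := hne θ s
        rw [hut_eq θ s hs]
        field_simp
        ring
      have h1 : Continuous fun θ => (u θ s ^ 2)⁻¹ :=
        (hpow_c 2).comp (Continuous.prodMk_left s)
      have h2 : Continuous fun θ => kappa θ s := hkappa_c.comp (Continuous.prodMk_left s)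
      simp only [hint]
      rw [intervalIntegral.integral_add (Continuous.intervalIntegrable (by fun_prop) _ _)
        (Continuous.intervalIntegrable (by fun_prop) _ _)]
      simp only [intervalIntegral.integral_const_mul]
      have h3 := (hden s).ne'
      linear_combination (1 / 2 : ℝ) * (eq_div_iff h3).1 (hkbar s)
    refine Eq.trans ?_ hnorm
    exact constant_of_has_deriv_right_zero (a := 0) (b := t)
      (f := fun s => ∫ θ in (0:ℝ)..(2 * π), ((u θ s) ^ 2)⁻¹)
      (fun s hs => (hd s hs.1).continuousAt.continuousWithinAt)
      (fun s hs => (hd s hs.1).hasDerivWithinAt) t ⟨ht, le_rfl⟩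
  intro t ht
  have hA' : ∀ s, A s = 1 / 2 * ∫ θ in (0:ℝ)..(2 * π), supportOf (fun φ => w φ s) θ * w θ s := by
    intro s
    rw [hA]
    simp only [hh]
    rfl
  have hdA := (hasDerivAt_intervalIntegral_of_continuous
    (F := fun θ s => supportOf (fun φ => w φ s) θ * w θ s)
    (F' := fun θ s => supportOf (fun φ => v φ s) θ * w θ s +
      supportOf (fun φ => w φ s) θ * v θ s)
    (fun s => (continuous_supportOf (hwt_c s)).mul (hwt_c s))
    (((continuous_supportOf_param hv_c).mul hw_c).add
      ((continuous_supportOf_param hw_c).mul hv_c))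
    (fun θ s => (hasDerivAt_supportOf_param hwt_c hv_c hdw θ s).fun_mul (hdw θ s))
    0 (2 * π) t).const_mul (1 / 2 : ℝ)
  have hwu : ∀ θ, w θ t * u θ t = (u θ t ^ 2)⁻¹ := by
    intro θ
    have := hne θ t
    simp only [hw_def]
    field_simp
  have hvar := integral_variation_supportOf (w := fun φ => w φ t) (f := fun θ => u θ t)
    (f' := fun θ => u1 θ t) (f'' := fun θ => u2 θ t) (hwt_c t) (horthc t ht) (horths t ht)
    (fun θ => hd1 θ t) (fun θ => hd2 θ t) (hu2t_c t) (-(3 / 4)) (3 / 4 * kbar t)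
  simp only [hwu, hnorm_t t ht] at hvar
  rw [funext hA', hdA.deriv]
  simp only [hv_eq t ht]
  rw [hvar]
  ring
end

section
/- Let h : ℝ → ℝ be a smooth 2π-periodic function such that h(θ) + h''(θ) > 0 for all θ, and suppose ∫_0^{2π} (h(θ) + h''(θ))·cos 2θ dθ = ∫_0^{2π} (h(θ) + h''(θ))·sin 2θ dθ = 0. Set A = (1/2)·∫_0^{2π} h(θ)·(h(θ) + h''(θ)) dθ. Then A ≥ 0 and ∫_0^{2π} (h(θ) + h''(θ)) dθ ≤ 2·√(6π·A). -/
open Real MeasureTheory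

/-- Lower bound for the kernel `(π - t) sin t - cos t / 2 + (2 / 3) cos 2t`, written in terms of
the variable `s = π - t`. -/
lemma one_sixth_le_mul_sin_add {s : ℝ} (h₁ : -π ≤ s) (h₂ : s ≤ π) :
    1 / 6 ≤ s * sin s + cos s / 2 + 2 / 3 * cos (2 * s) := by
  obtain ⟨x, rfl⟩ : ∃ x, s = 2 * x := ⟨s / 2, by ring⟩
  have hc : 0 ≤ cos x := cos_nonneg_of_mem_Icc ⟨by linarith, by linarith⟩
  have hx : sin x ^ 2 ≤ x * sin x := by
    rcases le_total 0 x with h0 | h0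
    · nlinarith [sin_le h0, sin_nonneg_of_nonneg_of_le_pi h0 (by linarith [pi_pos])]
    · nlinarith [le_sin h0, sin_nonpos_of_nonpos_of_neg_pi_le h0 (by linarith [pi_pos])]
  have hq : sin x ^ 2 = 1 - cos x ^ 2 := sin_sq x
  have hc1 : cos x ≤ 1 := cos_le_one x
  have key : 0 ≤ 12 * (x * sin x) - cos x * (13 - 16 * cos x ^ 2) := by
    nlinarith [mul_nonneg hc (sq_nonneg (cos x - 1)), sq_nonneg (cos x - 1),
      mul_nonneg hc (sub_nonneg.2 hc1), mul_nonneg hc (sq_nonneg (2 * cos x - 1))]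
  have := mul_nonneg hc key
  rw [cos_two_mul (2 * x), sin_two_mul, cos_two_mul]
  nlinarith

section Periodic

variable {h : ℝ → ℝ}

lemma hasDerivAt_of_contDiff_top (hsm : ContDiff ℝ (⊤ : ℕ∞) h) (θ : ℝ) :
    HasDerivAt h (deriv h θ) θ :=
  (hsm.differentiable (by simp) θ).hasDerivAt

lemma contDiff_top_deriv (hsm : ContDiff ℝ (⊤ : ℕ∞) h) : ContDiff ℝ (⊤ : ℕ∞) (deriv h) :=
  (contDiff_infty_iff_deriv.1 hsm).2

lemma periodic_deriv {c : ℝ} (hper : Function.Periodic h c) : Function.Periodic (deriv h) c := by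
  intro θ
  rw [← deriv_comp_add_const]
  exact congrArg (fun f => deriv f θ) (funext hper)

lemma integral_comp_add_of_periodic {c : ℝ} (hper : Function.Periodic h c) (θ : ℝ) :
    ∫ t in (0 : ℝ)..c, h (θ + t) = ∫ t in (0 : ℝ)..c, h t := by
  rw [intervalIntegral.integral_comp_add_left, add_zero]
  simpa using hper.intervalIntegral_add_eq θ 0

/-- Integration by parts over a period against a smooth function `u`. -/
lemma integral_mul_add_deriv_deriv (hsm : ContDiff ℝ (⊤ : ℕ∞) h) {u u' u'' : ℝ → ℝ}
    (hu : ∀ t, HasDerivAt u (u' t) t) (hu' : ∀ t, HasDerivAt u' (u'' t) t)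
    (hu'' : Continuous u'') (a b : ℝ) :
    ∫ t in a..b, u t * (h t + deriv (deriv h) t) =
      (u b * deriv h b - u' b * h b) - (u a * deriv h a - u' a * h a)
        + ∫ t in a..b, (u t + u'' t) * h t := by
  have h1 := contDiff_top_deriv hsm
  have c0 : Continuous h := hsm.continuous
  have c2 : Continuous (deriv (deriv h)) := (contDiff_top_deriv h1).continuous
  have cu : Continuous u := continuous_iff_continuousAt.2 fun t => (hu t).continuousAt
  rw [← sub_eq_iff_eq_add, ← intervalIntegral.integral_sub
    (Continuous.intervalIntegrable (by fun_prop) _ _)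
    (Continuous.intervalIntegrable (by fun_prop) _ _)]
  refine intervalIntegral.integral_eq_sub_of_hasDerivAt
    (f := fun t => u t * deriv h t - u' t * h t) (fun t _ => ?_)
    (Continuous.intervalIntegrable (by fun_prop) _ _)
  refine (((hu t).mul (hasDerivAt_of_contDiff_top h1 t)).sub
    ((hu' t).mul (hasDerivAt_of_contDiff_top hsm t))).congr_deriv ?_
  ring

lemma integral_mul_cos_eq_zero (hsm : ContDiff ℝ (⊤ : ℕ∞) h)
    (hper : Function.Periodic h (2 * π)) :
    ∫ t in (0 : ℝ)..(2 * π), (h t + deriv (deriv h) t) * cos t = 0 := by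
  have := integral_mul_add_deriv_deriv hsm (u := cos) (u' := fun t => -sin t)
    (u'' := fun t => -cos t) hasDerivAt_cos (fun t => (hasDerivAt_sin t).neg) (by fun_prop)
    0 (2 * π)
  have e := hper.eq
  have e' := (periodic_deriv hper).eq
  simp_rw [mul_comm _ (cos _)]
  simp [this, e, e']

lemma integral_mul_sin_eq_zero (hsm : ContDiff ℝ (⊤ : ℕ∞) h)
    (hper : Function.Periodic h (2 * π)) :
    ∫ t in (0 : ℝ)..(2 * π), (h t + deriv (deriv h) t) * sin t = 0 := by
  have := integral_mul_add_deriv_deriv hsm (u := sin) (u' := cos)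
    (u'' := fun t => -sin t) hasDerivAt_sin hasDerivAt_cos (by fun_prop) 0 (2 * π)
  have e := hper.eq
  simp_rw [mul_comm _ (sin _)]
  simp [this, e]

/-- A function recovered from `h + h''`, up to its first Fourier modes. -/
lemma integral_pi_sub_mul_sin_mul (hsm : ContDiff ℝ (⊤ : ℕ∞) h)
    (hper : Function.Periodic h (2 * π)) :
    ∫ t in (0 : ℝ)..(2 * π), (π - t) * sin t * (h t + deriv (deriv h) t) =
      2 * π * h 0 - 2 * ∫ t in (0 : ℝ)..(2 * π), h t * cos t := by
  have := integral_mul_add_deriv_deriv hsm (u := fun t => (π - t) * sin t)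
    (u' := fun t => (π - t) * cos t - sin t)
    (u'' := fun t => -(π - t) * sin t - 2 * cos t)
    (fun t => by
      refine (((hasDerivAt_id t).const_sub π).mul (hasDerivAt_sin t)).congr_deriv ?_
      simp only [id_eq]; ring)
    (fun t => by
      refine ((((hasDerivAt_id t).const_sub π).mul (hasDerivAt_cos t)).sub
        (hasDerivAt_sin t)).congr_deriv ?_
      simp only [id_eq]; ring)
    (by fun_prop) 0 (2 * π)
  rw [this, hper.eq, sub_eq_add_neg (2 * π * h 0), ← intervalIntegral.integral_const_mul,
    ← intervalIntegral.integral_neg]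
  congr 1
  · simp; ring
  · congr 1; ext t; ring

/-- Pointwise lower bound for a function whose `h + h''` is positive and has vanishing second
Fourier cosine coefficient. -/
lemma integral_div_six_le (hsm : ContDiff ℝ (⊤ : ℕ∞) h)
    (hper : Function.Periodic h (2 * π)) (hconv : ∀ θ, 0 < h θ + deriv (deriv h) θ)
    (hc2 : ∫ t in (0 : ℝ)..(2 * π), (h t + deriv (deriv h) t) * cos (2 * t) = 0) :
    (∫ t in (0 : ℝ)..(2 * π), (h t + deriv (deriv h) t)) / 6 ≤
      2 * π * h 0 - 2 * ∫ t in (0 : ℝ)..(2 * π), h t * cos t := by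
  have c0 : Continuous h := hsm.continuous
  have c2 : Continuous (deriv (deriv h)) := (contDiff_top_deriv (contDiff_top_deriv hsm)).continuous
  have hmono : ∫ t in (0 : ℝ)..(2 * π), (1 / 6) * (h t + deriv (deriv h) t) ≤
      ∫ t in (0 : ℝ)..(2 * π), ((π - t) * sin t * (h t + deriv (deriv h) t)
        - (1 / 2) * ((h t + deriv (deriv h) t) * cos t)
        + (2 / 3) * ((h t + deriv (deriv h) t) * cos (2 * t))) := by
    refine intervalIntegral.integral_mono_on (by positivity)
      (Continuous.intervalIntegrable (by fun_prop) _ _)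
      (Continuous.intervalIntegrable (by fun_prop) _ _) fun t ht => ?_
    have hk := one_sixth_le_mul_sin_add (s := π - t) (by linarith [ht.2]) (by linarith [ht.1])
    have hcos : cos (2 * (π - t)) = cos (2 * t) := by
      rw [mul_sub, cos_two_pi_sub]
    rw [sin_pi_sub, cos_pi_sub, hcos] at hk
    linarith [mul_le_mul_of_nonneg_right hk (hconv t).le]
  rw [intervalIntegral.integral_add (Continuous.intervalIntegrable (by fun_prop) _ _)
      (Continuous.intervalIntegrable (by fun_prop) _ _),
    intervalIntegral.integral_sub (Continuous.intervalIntegrable (by fun_prop) _ _)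
      (Continuous.intervalIntegrable (by fun_prop) _ _),
    intervalIntegral.integral_const_mul, intervalIntegral.integral_const_mul,
    intervalIntegral.integral_const_mul, hc2, integral_mul_cos_eq_zero hsm hper,
    integral_pi_sub_mul_sin_mul hsm hper] at hmono
  linarith

/-- The Fourier coefficients of a translate. -/
lemma integral_comp_add_mul_cos (hcont : Continuous h) (hper : Function.Periodic h (2 * π))
    (n : ℕ) (θ : ℝ) :
    ∫ t in (0 : ℝ)..(2 * π), h (θ + t) * cos (n * t) =
      (∫ t in (0 : ℝ)..(2 * π), h t * cos (n * t)) * cos (n * θ)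
        + (∫ t in (0 : ℝ)..(2 * π), h t * sin (n * t)) * sin (n * θ) := by
  have hp : Function.Periodic (fun t => h t * cos (n * (t - θ))) (2 * π) := by
    intro t
    have : (n : ℝ) * (t + 2 * π - θ) = n * (t - θ) + n * (2 * π) := by ring
    simp only [hper t, this, cos_add_nat_mul_two_pi]
  have := integral_comp_add_of_periodic hp θ
  simp only [add_sub_cancel_left] at this
  rw [this, ← intervalIntegral.integral_mul_const, ← intervalIntegral.integral_mul_const,
    ← intervalIntegral.integral_add (Continuous.intervalIntegrable (by fun_prop) _ _)
      (Continuous.intervalIntegrable (by fun_prop) _ _)]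
  congr 1
  ext t
  rw [mul_sub, cos_sub]
  ring

end Periodic

/-- Length–area estimate for a convex curve with support function `h` whose
radius of curvature `h + h''` has vanishing second Fourier coefficients:
the perimeter `∫ (h + h'') dθ` is at most `2√(6πA)`, where
`A = ½∫ h(h + h'') dθ` is the enclosed area (and `A ≥ 0`). -/
theorem perimeter_le_of_second_fourier_vanishing
    (h : ℝ → ℝ)
    (hsm : ContDiff ℝ (⊤ : ℕ∞) h)
    (hper : ∀ θ, h (θ + 2 * π) = h θ)
    (hconv : ∀ θ, 0 < h θ + deriv (deriv h) θ)
    (hc2 : ∫ θ in (0:ℝ)..(2 * π), (h θ + deriv (deriv h) θ) * Real.cos (2 * θ) = 0)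
    (hs2 : ∫ θ in (0:ℝ)..(2 * π), (h θ + deriv (deriv h) θ) * Real.sin (2 * θ) = 0)
    (A : ℝ)
    (hA : A = (1 / 2) * ∫ θ in (0:ℝ)..(2 * π), h θ * (h θ + deriv (deriv h) θ)) :
    0 ≤ A ∧
      (∫ θ in (0:ℝ)..(2 * π), (h θ + deriv (deriv h) θ))
        ≤ 2 * Real.sqrt (6 * π * A) := by
  have hP : Function.Periodic h (2 * π) := hper
  have c0 : Continuous h := hsm.continuous
  have c2 : Continuous (deriv (deriv h)) := (contDiff_top_deriv (contDiff_top_deriv hsm)).continuous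
  have hρP : Function.Periodic (fun t => h t + deriv (deriv h) t) (2 * π) :=
    hP.add (periodic_deriv (periodic_deriv hP))
  set P := ∫ θ in (0:ℝ)..(2 * π), (h θ + deriv (deriv h) θ) with hPdef
  set a := ∫ t in (0 : ℝ)..(2 * π), h t * cos t with ha
  set b := ∫ t in (0 : ℝ)..(2 * π), h t * sin t with hb
  have hpt : ∀ θ, P / 6 ≤ 2 * π * h θ - 2 * (a * cos θ + b * sin θ) := by
    intro θ
    have hd : deriv (deriv fun t => h (θ + t)) = fun t => deriv (deriv h) (θ + t) := by
      have : (deriv fun t => h (θ + t)) = fun t => deriv h (θ + t) :=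
        funext fun t => deriv_comp_const_add h θ t
      rw [this]
      exact funext fun t => deriv_comp_const_add (deriv h) θ t
    have hmain := integral_div_six_le (h := fun t => h (θ + t)) (hsm.comp (by fun_prop))
      (fun t => by simpa only [add_assoc] using hper (θ + t))
      (fun t => by rw [hd]; exact hconv (θ + t))
      (by
        have := integral_comp_add_mul_cos (by fun_prop) hρP 2 θ
        simp only [Nat.cast_ofNat, hc2, hs2] at this
        simpa [hd] using this)
    have hcos := integral_comp_add_mul_cos c0 hP 1 θ
    simp only [Nat.cast_one, one_mul] at hcos
    have hshift := integral_comp_add_of_periodic hρP θ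
    simp only [hd, add_zero] at hmain
    rw [hcos, hshift] at hmain
    exact hmain
  have hint : ∫ θ in (0:ℝ)..(2 * π), P / 6 * (h θ + deriv (deriv h) θ) ≤
      ∫ θ in (0:ℝ)..(2 * π), (2 * π * (h θ * (h θ + deriv (deriv h) θ))
        - 2 * a * ((h θ + deriv (deriv h) θ) * cos θ)
        - 2 * b * ((h θ + deriv (deriv h) θ) * sin θ)) := by
    refine intervalIntegral.integral_mono_on (by positivity)
      (Continuous.intervalIntegrable (by fun_prop) _ _)
      (Continuous.intervalIntegrable (by fun_prop) _ _) fun θ _ => ?_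
    linarith [mul_le_mul_of_nonneg_right (hpt θ) (hconv θ).le]
  rw [intervalIntegral.integral_sub (Continuous.intervalIntegrable (by fun_prop) _ _)
      (Continuous.intervalIntegrable (by fun_prop) _ _),
    intervalIntegral.integral_sub (Continuous.intervalIntegrable (by fun_prop) _ _)
      (Continuous.intervalIntegrable (by fun_prop) _ _),
    intervalIntegral.integral_const_mul, intervalIntegral.integral_const_mul,
    intervalIntegral.integral_const_mul, intervalIntegral.integral_const_mul,
    integral_mul_cos_eq_zero hsm hP, integral_mul_sin_eq_zero hsm hP, ← hPdef] at hint
  have hsq : P ^ 2 ≤ 4 * (6 * π * A) := by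
    rw [hA]
    linarith
  have hA0 : 0 ≤ A := by
    have : 0 ≤ π * A := by nlinarith [sq_nonneg P]
    exact nonneg_of_mul_nonneg_right this pi_pos
  refine ⟨hA0, ?_⟩
  have := le_sqrt_of_sq_le (show (P / 2) ^ 2 ≤ 6 * π * A by linarith)
  linarith
end
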